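/- Let G be a weighted directed graph with nonnegative edge weights, edge set E = P ∪ F, and vertices u, v. Let V(F) be the endpoints of edges in F. Define the weighted graph H on vertex set V(F) ∪ {u, v}: include every edge of the induced subgraph G[V(F) ∪ {u,v}] with its weight, and for every pair (a, b) of vertices of H, include an edge of weight dist_{(V,P)}(a, b) (the shortest-path distance from a to b using only edges in P) whenever this distance is finite, taking the minimum weight when both edges exist. Then dist_G(u, v) = dist_H(u, v). -/

import Mathlib

open scoped ENNReal Classical

/-- The cost of a walk, given as the list of its vertices, in a weighted directed graph
with weight matrix `A` (where `A a b = ⊤` means there is no edge from `a` to `b`). -/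
noncomputable def listCost {V : Type*} (A : V → V → ℝ≥0∞) : List V → ℝ≥0∞
  | [] => ⊤
  | [_] => 0
  | a :: b :: rest => A a b + listCost A (b :: rest)

/-- The shortest-path distance from `u` to `v` in the weighted directed graph with
weight matrix `A`: the infimum of the costs of all walks from `u` to `v` (`⊤` = `+∞`
if no walk exists). -/
noncomputable def wdist {V : Type*} (A : V → V → ℝ≥0∞) (u v : V) : ℝ≥0∞ :=
  ⨅ (l : List V) (_ : l.head? = some u) (_ : l.getLast? = some v), listCost A l

/-- The edge set of the weighted digraph with weight matrix `A`. -/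
def edgeSetOf {V : Type*} (A : V → V → ℝ≥0∞) : Set (V × V) := {p | A p.1 p.2 ≠ ⊤}

theorem wdist_le_list {V : Type*} (A : V → V → ℝ≥0∞) {u v : V} (l : List V)
    (h1 : l.head? = some u) (h2 : l.getLast? = some v) : wdist A u v ≤ listCost A l :=
  iInf_le_of_le l (iInf_le_of_le h1 (iInf_le _ h2))

theorem wdist_self' {V : Type*} (A : V → V → ℝ≥0∞) (u : V) : wdist A u u = 0 := by
  have := wdist_le_list A (u := u) (v := u) [u] rfl rfl
  simpa [listCost] using this

theorem wdist_step {V : Type*} (A : V → V → ℝ≥0∞) (a b c : V) :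
    wdist A a c ≤ A a b + wdist A b c := by
  rw [← tsub_le_iff_left]
  refine le_iInf fun l => le_iInf fun h1 => le_iInf fun h2 => ?_
  rw [tsub_le_iff_left]
  cases l with
  | nil => simp at h1
  | cons x t =>
    simp only [List.head?_cons, Option.some.injEq] at h1
    subst h1
    have := wdist_le_list A (u := a) (v := c) (a :: x :: t) rfl (by simpa using h2)
    simpa [listCost] using this

theorem potential_list {V : Type*} (A : V → V → ℝ≥0∞) (f : V → ℝ≥0∞)
    (h : ∀ a b, f a ≤ A a b + f b) (v : V) (l : List V) : ∀ u, l.head? = some u →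
    l.getLast? = some v → f u ≤ listCost A l + f v := by
  induction l with
  | nil => intro u h1; simp at h1
  | cons x t ih =>
    intro u h1 h2
    simp only [List.head?_cons, Option.some.injEq] at h1
    subst h1
    cases t with
    | nil =>
      simp at h2
      subst h2
      simp [listCost]
    | cons y t =>
      have h3 := ih y rfl (by simpa using h2)
      calc f x ≤ A x y + f y := h x y
        _ ≤ A x y + (listCost A (y :: t) + f v) := by gcongr
        _ = _ := by simp [listCost, add_assoc]

theorem potential {V : Type*} (A : V → V → ℝ≥0∞) (f : V → ℝ≥0∞)
    (h : ∀ a b, f a ≤ A a b + f b) (u v : V) : f u ≤ wdist A u v + f v := by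
  rw [← tsub_le_iff_right]
  refine le_iInf fun l => le_iInf fun h1 => le_iInf fun h2 => ?_
  rw [tsub_le_iff_right]
  exact potential_list A f h v l u h1 h2

theorem wdist_triangle {V : Type*} (A : V → V → ℝ≥0∞) (a b c : V) :
    wdist A a c ≤ wdist A a b + wdist A b c :=
  potential A (fun x => wdist A x c) (fun x y => wdist_step A x y c) a b

theorem wdist_le_edge {V : Type*} (A : V → V → ℝ≥0∞) (a b : V) : wdist A a b ≤ A a b := by
  simpa [wdist_self'] using wdist_step A a b b

/-- If every edge of `B` costs at least the `A`-distance, distances compare. -/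
theorem wdist_le_wdist {V : Type*} (A B : V → V → ℝ≥0∞) (h : ∀ a b, wdist A a b ≤ B a b)
    (u v : V) : wdist A u v ≤ wdist B u v := by
  have := potential B (fun x => wdist A x v)
    (fun x y => (wdist_triangle A x y v).trans (by gcongr; exact h x y)) u v
  simpa [wdist_self'] using this

theorem core {V : Type*} (A Q H : V → V → ℝ≥0∞) (S : Set V) (u v : V) (hu : u ∈ S) (hv : v ∈ S)
    (hAQ : ∀ a b, A a b ≤ Q a b)
    (hQ : ∀ a b, A a b = ⊤ ∨ Q a b = A a b ∨ (a ∈ S ∧ b ∈ S))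
    (hH : ∀ a b, H a b = if a ∈ S ∧ b ∈ S then min (A a b) (wdist Q a b) else ⊤) :
    wdist A u v = wdist H u v := by
  have hHA : ∀ a ∈ S, ∀ b ∈ S, H a b ≤ A a b := fun a ha b hb => by
    rw [hH, if_pos ⟨ha, hb⟩]; exact min_le_left _ _
  have hHQ : ∀ a ∈ S, ∀ b ∈ S, H a b ≤ wdist Q a b := fun a ha b hb => by
    rw [hH, if_pos ⟨ha, hb⟩]; exact min_le_right _ _
  have key : ∀ a ∈ S, ∀ c ∈ S, wdist H a v ≤ wdist Q a c + wdist H c v := fun a ha c hc =>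
    (wdist_step H a c v).trans (by gcongr; exact hHQ a ha c hc)
  apply le_antisymm
  · apply wdist_le_wdist
    intro a b
    rw [hH]
    split_ifs
    · refine le_min (wdist_le_edge A a b) (wdist_le_wdist A Q ?_ a b)
      exact fun x y => (wdist_le_edge A x y).trans (hAQ x y)
    · exact le_top
  · have hp := potential A (fun a => ⨅ c : S, wdist Q a c + wdist H c v) ?_ u v
    · have h0 : (⨅ c : S, wdist Q v c + wdist H c v) = 0 := by
        refine le_antisymm (iInf_le_of_le ⟨v, hv⟩ ?_) bot_le
        simp [wdist_self']
      rw [h0, add_zero] at hp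
      refine le_trans (le_iInf fun c => ?_) hp
      exact key u hu c c.2
    · intro a b
      rw [← tsub_le_iff_left]
      refine le_iInf fun c => ?_
      rw [tsub_le_iff_left]
      rcases hQ a b with h | h | ⟨ha, hb⟩
      · simp [h]
      · refine iInf_le_of_le c ?_
        rw [← h, ← add_assoc]
        gcongr
        exact wdist_step Q a b c
      · refine iInf_le_of_le ⟨a, ha⟩ ?_
        simp only [wdist_self', zero_add]
        calc wdist H a v ≤ H a b + wdist H b v := wdist_step H a b v
          _ ≤ A a b + (wdist Q b c + wdist H c v) := by
            gcongr
            · exact hHA a ha b hb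
            · exact key b hb c c.2

/-- Let `G` be a weighted directed digraph with (nonnegative) weight matrix `A` and
edge set `E = P ∪ F` where `P ⊆ E` is the set of 'permanent' edges and `F = E \ P`.
Let `V(F)` be the set of endpoints of edges in `F`.  Let `H` be the weighted graph on
the vertices `V(F) ∪ {u, v}` containing every edge of the induced subgraph with its
weight and, for every pair `(a, b)`, an edge of weight `dist_{(V,P)}(a, b)` whenever
this distance is finite, taking the minimum weight when both exist.  Then
`dist_G(u, v) = dist_H(u, v)`. -/
theorem stmt16 {V : Type*} (A : V → V → ℝ≥0∞) (P : Set (V × V)) (u v : V)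
    (hP : P ⊆ edgeSetOf A) :
    wdist A u v =
      wdist (fun a b =>
        if a ∈ ({w | ∃ z, (w, z) ∈ edgeSetOf A \ P ∨ (z, w) ∈ edgeSetOf A \ P} : Set V)
              ∪ {u, v} ∧
           b ∈ ({w | ∃ z, (w, z) ∈ edgeSetOf A \ P ∨ (z, w) ∈ edgeSetOf A \ P} : Set V)
              ∪ {u, v}
        then min (A a b) (wdist (fun x y => if (x, y) ∈ P then A x y else ⊤) a b)
        else ⊤) u v := by
  refine core A (fun x y => if (x, y) ∈ P then A x y else ⊤) _
    (({w | ∃ z, (w, z) ∈ edgeSetOf A \ P ∨ (z, w) ∈ edgeSetOf A \ P} : Set V) ∪ {u, v}) u v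
    (by simp) (by simp) ?_ ?_ (fun a b => by congr)
  · intro a b
    split_ifs
    · exact le_rfl
    · exact le_top
  · intro a b
    by_cases hA : A a b = ⊤
    · exact Or.inl hA
    · by_cases hp : (a, b) ∈ P
      · exact Or.inr (Or.inl (if_pos hp))
      · exact Or.inr (Or.inr ⟨Or.inl ⟨b, Or.inl ⟨hA, hp⟩⟩, Or.inl ⟨a, Or.inr ⟨hA, hp⟩⟩⟩)
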